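/- arXiv:1912.05175 — 5 statements merged into one kernel-verified Lean document; each statement's English description precedes it below -/
import Mathlib

section
/- Let V be a finite-dimensional real inner product space, let r ≥ 1, let χ be an (r+1)-fold vector cross product on V, and let e₁,…,e_r be an orthonormal system in V spanning the subspace v, with orthogonal complement v^⊥. Then: (1) for every ξ ∈ v^⊥ the vector χ(e₁,…,e_r,ξ) lies in v^⊥; (2) the linear map J : v^⊥ → v^⊥ given by J(ξ) = χ(e₁,…,e_r,ξ) is a 1-fold vector cross product on v^⊥, i.e. ⟪Jξ, ξ⟫ = 0 and ‖Jξ‖ = ‖ξ‖ for all ξ ∈ v^⊥; and (3) φ_χ(e₁,…,e_r,ξ,ζ) = ⟪Jξ, ζ⟫ for all ξ,ζ ∈ v^⊥. -/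
open RealInnerProductSpace

/-- An `r`-fold vector cross product on a real inner product space `V`:
an alternating `r`-linear map `χ : Vʳ → V` such that `χ(v₁,…,v_r)` is orthogonal to each
argument and `‖χ(v₁,…,v_r)‖²` equals the Gram determinant of the arguments. -/
def IsVCP {V : Type*} [NormedAddCommGroup V] [InnerProductSpace ℝ V] {r : ℕ}
    (χ : V [⋀^Fin r]→ₗ[ℝ] V) : Prop :=
  (∀ v : Fin r → V, ∀ i : Fin r, ⟪χ v, v i⟫ = 0) ∧
  (∀ v : Fin r → V, ‖χ v‖ ^ 2 = (Matrix.of fun i j : Fin r => ⟪v i, v j⟫).det)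

/-- Lee–Leung's lemma: for an `(r+1)`-fold VCP `χ` and an orthonormal system `e₁,…,e_r`
spanning `v`, contraction of `χ` with `e₁,…,e_r` preserves `v^⊥` and defines a `1`-fold
VCP `J` on `v^⊥`, whose fundamental form is the contraction of the VCP-form `φ_χ`. -/
theorem lee_leung_lemma {V : Type*} [NormedAddCommGroup V] [InnerProductSpace ℝ V]
    [FiniteDimensional ℝ V] {r : ℕ} (hr : 1 ≤ r)
    (χ : V [⋀^Fin (r + 1)]→ₗ[ℝ] V) (hχ : IsVCP χ)
    (e : Fin r → V) (he : Orthonormal ℝ e)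
    (v : Submodule ℝ V) (hv : v = Submodule.span ℝ (Set.range e))
    (J : V → V) (hJ : ∀ ξ : V, J ξ = χ (Fin.snoc e ξ)) :
    (∀ ξ ∈ vᗮ, J ξ ∈ vᗮ) ∧
    (∀ ξ ∈ vᗮ, ⟪J ξ, ξ⟫ = 0 ∧ ‖J ξ‖ = ‖ξ‖) ∧
    (∀ ξ ∈ vᗮ, ∀ ζ ∈ vᗮ, ⟪χ (Fin.snoc e ξ), ζ⟫ = ⟪J ξ, ζ⟫) := by
  have hE : ∀ ξ ∈ vᗮ, ∀ i, ⟪e i, ξ⟫ = 0 := by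
    intro ξ hξ i
    exact (Submodule.mem_orthogonal v ξ).1 hξ (e i)
      (by rw [hv]; exact Submodule.subset_span ⟨i, rfl⟩)
  refine ⟨?_, ?_, ?_⟩
  · intro ξ _
    rw [hv, Submodule.mem_orthogonal]
    intro u hu
    induction hu using Submodule.span_induction with
    | mem x hx =>
      obtain ⟨i, rfl⟩ := hx
      have h := hχ.1 (Fin.snoc e ξ) (Fin.castSucc i)
      rw [Fin.snoc_castSucc (α := fun _ => V)] at h
      rw [hJ, real_inner_comm]
      exact h
    | zero => simp
    | add x y _ _ hx hy => rw [inner_add_left, hx, hy, add_zero]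
    | smul a x _ hx => rw [real_inner_smul_left, hx, mul_zero]
  · intro ξ hξ
    refine ⟨?_, ?_⟩
    · have h := hχ.1 (Fin.snoc e ξ) (Fin.last r)
      rw [Fin.snoc_last (α := fun _ => V)] at h
      rw [hJ]
      exact h
    · have h := hχ.2 (Fin.snoc e ξ)
      have hM : (Matrix.of fun i j : Fin (r + 1) =>
          ⟪(Fin.snoc e ξ : Fin (r + 1) → V) i, (Fin.snoc e ξ : Fin (r + 1) → V) j⟫)
          = Matrix.diagonal (Fin.snoc (fun _ => (1 : ℝ)) (‖ξ‖ ^ 2) : Fin (r + 1) → ℝ) := by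
        ext i j
        refine Fin.lastCases ?_ (fun i => ?_) i <;> refine Fin.lastCases ?_ (fun j => ?_) j
        · simp
        · simp [(real_inner_comm _ _).trans (hE ξ hξ j), (Fin.castSucc_lt_last j).ne']
        · simp [Matrix.diagonal_apply, hE ξ hξ i, (Fin.castSucc_lt_last i).ne]
        · simp [Matrix.diagonal_apply, orthonormal_iff_ite.1 he i j]
      rw [hM, Matrix.det_diagonal, Fin.prod_univ_castSucc] at h
      simp only [Fin.snoc_castSucc, Fin.snoc_last, Finset.prod_const_one, one_mul] at h
      rw [hJ]
      exact (sq_eq_sq₀ (norm_nonneg _) (norm_nonneg _)).1 h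
  · intro ξ _ ζ _
    rw [hJ]
end

section
/- Let V be a finite-dimensional real inner product space, let r ≥ 1, let χ be an (r+1)-fold vector cross product on V, and let e₁,…,e_r be an orthonormal system in V. Then for every vector ξ ∈ V orthogonal to each eᵢ one has ‖χ(e₁,…,e_r,ξ)‖ = ‖ξ‖ and χ(e₁,…,e_r, χ(e₁,…,e_r,ξ)) = −ξ. -/
open RealInnerProductSpace

/-- For an `(r+1)`-fold VCP `χ` and an orthonormal system `e₁,…,e_r`, the contraction
`ξ ↦ χ(e₁,…,e_r,ξ)` is an isometry on vectors orthogonal to all `eᵢ`, and applying it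
twice to such a vector gives `-ξ`. -/
theorem vcp_contraction_isometry_and_square_neg_one {V : Type*} [NormedAddCommGroup V]
    [InnerProductSpace ℝ V] [FiniteDimensional ℝ V] {r : ℕ} (hr : 1 ≤ r)
    (χ : V [⋀^Fin (r + 1)]→ₗ[ℝ] V) (hχ : IsVCP χ)
    (e : Fin r → V) (he : Orthonormal ℝ e)
    (ξ : V) (hξ : ∀ i : Fin r, ⟪ξ, e i⟫ = 0) :
    ‖χ (Fin.snoc e ξ)‖ = ‖ξ‖ ∧
    χ (Fin.snoc e (χ (Fin.snoc e ξ))) = -ξ := by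
  obtain ⟨h1, h2⟩ := hχ
  have hnorm : ∀ x : V, (∀ i : Fin r, ⟪x, e i⟫ = 0) → ‖χ (Fin.snoc e x)‖ ^ 2 = ‖x‖ ^ 2 := by
    intro x hx
    have hM : (Matrix.of fun i j : Fin (r + 1) =>
        ⟪(Fin.snoc e x : Fin (r + 1) → V) i, (Fin.snoc e x : Fin (r + 1) → V) j⟫)
        = Matrix.diagonal (Fin.snoc (fun _ : Fin r => (1 : ℝ)) (‖x‖ ^ 2) : Fin (r + 1) → ℝ) := by
      ext i j
      refine Fin.lastCases ?_ (fun i => ?_) i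
      · refine Fin.lastCases ?_ (fun j => ?_) j
        · simp [real_inner_self_eq_norm_sq]
        · simp [hx j, Matrix.diagonal_apply, (Fin.castSucc_lt_last j).ne']
      · refine Fin.lastCases ?_ (fun j => ?_) j
        · simp [real_inner_comm, hx i, Matrix.diagonal_apply, (Fin.castSucc_lt_last i).ne]
        · simp [orthonormal_iff_ite.mp he i j, Matrix.diagonal_apply]
    rw [h2, hM, Matrix.det_diagonal, Fin.prod_univ_castSucc]
    simp
  have hadd : ∀ x y : V, χ (Fin.snoc e (x + y)) = χ (Fin.snoc e x) + χ (Fin.snoc e y) := by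
    intro x y
    have := χ.map_update_add (Fin.snoc e 0) (Fin.last r) x y
    simpa only [Fin.update_snoc_last] using this
  have hself : ∀ x : V, ⟪χ (Fin.snoc e x), x⟫ = 0 := by
    intro x
    simpa using h1 (Fin.snoc e x) (Fin.last r)
  have horth : ∀ (x : V) (i : Fin r), ⟪χ (Fin.snoc e x), e i⟫ = 0 := by
    intro x i
    simpa using h1 (Fin.snoc e x) i.castSucc
  have n1 := hnorm ξ hξ
  have n2 := hnorm _ (horth ξ)
  refine ⟨(sq_eq_sq₀ (norm_nonneg _) (norm_nonneg _)).mp n1, ?_⟩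
  have hs := hself (ξ + χ (Fin.snoc e ξ))
  rw [hadd, inner_add_left, inner_add_right, inner_add_right, hself, hself,
    real_inner_self_eq_norm_sq] at hs
  rw [← sub_eq_zero, sub_neg_eq_add, ← norm_eq_zero, ← sq_eq_zero_iff, norm_add_sq_real]
  linarith
end

section
/- Let V be a finite-dimensional real inner product space, let r ≥ 1, let χ be an (r+1)-fold vector cross product on V, let e₁,…,e_r be an orthonormal system spanning the subspace v, and let J : v^⊥ → v^⊥ be the map J(ξ) = χ(e₁,…,e_r,ξ) (which preserves v^⊥). Then for all ξ, ζ ∈ v^⊥ one has ⟪Jξ, Jζ⟫ = ⟪ξ, ζ⟫ and ⟪Jξ, ζ⟫ = −⟪ξ, Jζ⟫; moreover the bilinear form ω(ξ,ζ) := ⟪Jξ, ζ⟫ on v^⊥ is alternating and nondegenerate, with ω(ξ, Jξ) = ‖ξ‖² for all ξ ∈ v^⊥. -/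
open RealInnerProductSpace

/-- For an `(r+1)`-fold VCP `χ` and an orthonormal system `e₁,…,e_r` spanning `v`, the
map `J(ξ) = χ(e₁,…,e_r,ξ)` on `v^⊥` is orthogonal and skew-adjoint, and the bilinear form
`ω(ξ,ζ) = ⟪Jξ, ζ⟫` on `v^⊥` is alternating and nondegenerate with `ω(ξ, Jξ) = ‖ξ‖²`. -/
theorem vcp_contraction_hermitian_structure {V : Type*} [NormedAddCommGroup V]
    [InnerProductSpace ℝ V] [FiniteDimensional ℝ V] {r : ℕ} (hr : 1 ≤ r)
    (χ : V [⋀^Fin (r + 1)]→ₗ[ℝ] V) (hχ : IsVCP χ)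
    (e : Fin r → V) (he : Orthonormal ℝ e)
    (v : Submodule ℝ V) (hv : v = Submodule.span ℝ (Set.range e))
    (J : V → V) (hJ : ∀ ξ : V, J ξ = χ (Fin.snoc e ξ))
    (hJperp : ∀ ξ ∈ vᗮ, J ξ ∈ vᗮ)
    (ω : V → V → ℝ) (hω : ∀ ξ ζ : V, ω ξ ζ = ⟪J ξ, ζ⟫) :
    (∀ ξ ∈ vᗮ, ∀ ζ ∈ vᗮ, ⟪J ξ, J ζ⟫ = ⟪ξ, ζ⟫) ∧
    (∀ ξ ∈ vᗮ, ∀ ζ ∈ vᗮ, ⟪J ξ, ζ⟫ = -⟪ξ, J ζ⟫) ∧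
    (∀ ξ ∈ vᗮ, ω ξ ξ = 0) ∧
    (∀ ξ ∈ vᗮ, (∀ ζ ∈ vᗮ, ω ξ ζ = 0) → ξ = 0) ∧
    (∀ ξ ∈ vᗮ, ω ξ (J ξ) = ‖ξ‖ ^ 2) := by
  have hadd : ∀ x y, J (x + y) = J x + J y := by
    intro x y
    have h := χ.map_update_add (Fin.snoc e (0 : V) : Fin (r + 1) → V) (Fin.last r) x y
    simp only [Fin.update_snoc_last] at h
    rw [hJ, hJ, hJ, h]
  have hskew0 : ∀ x, ⟪J x, x⟫ = 0 := by
    intro x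
    have h := hχ.1 (Fin.snoc e x) (Fin.last r)
    rw [Fin.snoc_last] at h
    rw [hJ]
    exact h
  have horth : ∀ x ∈ vᗮ, ∀ i, ⟪e i, x⟫ = 0 := by
    intro x hx i
    refine (Submodule.mem_orthogonal v x).1 hx _ ?_
    rw [hv]
    exact Submodule.subset_span ⟨i, rfl⟩
  have hnorm : ∀ x ∈ vᗮ, ⟪J x, J x⟫ = ⟪x, x⟫ := by
    intro x hx
    rw [real_inner_self_eq_norm_sq, hJ, hχ.2]
    have hM : (Matrix.of fun i j : Fin (r + 1) =>
        ⟪(Fin.snoc e x : Fin (r + 1) → V) i, (Fin.snoc e x : Fin (r + 1) → V) j⟫) =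
        Matrix.diagonal (Fin.snoc (fun _ => (1 : ℝ)) ⟪x, x⟫ : Fin (r + 1) → ℝ) := by
      ext i j
      rw [Matrix.of_apply, Matrix.diagonal_apply]
      induction i using Fin.lastCases with
      | last =>
        induction j using Fin.lastCases with
        | last => simp
        | cast j =>
          rw [if_neg (Fin.castSucc_lt_last j).ne', Fin.snoc_last, Fin.snoc_castSucc,
            real_inner_comm]
          exact horth x hx j
      | cast i =>
        induction j using Fin.lastCases with
        | last =>
          rw [if_neg (Fin.castSucc_lt_last i).ne, Fin.snoc_last, Fin.snoc_castSucc]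
          exact horth x hx i
        | cast j =>
          simp only [Fin.snoc_castSucc, Fin.castSucc_inj]
          exact orthonormal_iff_ite.1 he i j
    rw [hM, Matrix.det_diagonal, Fin.prod_univ_castSucc]
    simp
  have hiso : ∀ ξ ∈ vᗮ, ∀ ζ ∈ vᗮ, ⟪J ξ, J ζ⟫ = ⟪ξ, ζ⟫ := by
    intro x hx y hy
    have h := hnorm (x + y) (vᗮ.add_mem hx hy)
    rw [hadd, real_inner_add_add_self, real_inner_add_add_self, hnorm x hx, hnorm y hy] at h
    linarith
  refine ⟨hiso, ?_, ?_, ?_, ?_⟩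
  · intro x _ y _
    have h := hskew0 (x + y)
    rw [hadd, inner_add_left, inner_add_right, inner_add_right, hskew0, hskew0] at h
    rw [real_inner_comm (J y) x]
    linarith
  · intro x _
    rw [hω, hskew0]
  · intro x hx h
    have h1 := h (J x) (hJperp x hx)
    rw [hω, hnorm x hx] at h1
    exact inner_self_eq_zero.1 h1
  · intro x hx
    rw [hω, hnorm x hx, real_inner_self_eq_norm_sq]
end

section
/- A finite-dimensional real inner product space V admits a 1-fold vector cross product (i.e. a linear map J : V → V with ⟪Jv, v⟫ = 0 and ‖Jv‖ = ‖v‖ for all v ∈ V) if and only if the dimension of V is even. -/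
open RealInnerProductSpace

/-- Brown–Gray classification, case (1): a finite-dimensional real inner product space
admits a `1`-fold vector cross product (a linear map `J` with `⟪Jv, v⟫ = 0` and
`‖Jv‖ = ‖v‖` for all `v`) if and only if its dimension is even. -/
theorem exists_one_fold_vcp_iff_even_finrank (V : Type*) [NormedAddCommGroup V]
    [InnerProductSpace ℝ V] [FiniteDimensional ℝ V] :
    (∃ J : V →ₗ[ℝ] V, (∀ v : V, ⟪J v, v⟫ = 0) ∧ (∀ v : V, ‖J v‖ = ‖v‖)) ↔
      Even (Module.finrank ℝ V) := by
  constructor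
  · rintro ⟨J, h1, h2⟩
    have hskew : ∀ v w, ⟪J v, w⟫ = -⟪v, J w⟫ := by
      intro v w
      have h := h1 (v + w)
      simp only [map_add, inner_add_left, inner_add_right, h1] at h
      rw [real_inner_comm (J w) v]
      linarith
    have hiso : ∀ v w, ⟪J v, J w⟫ = ⟪v, w⟫ := fun v w =>
      LinearIsometry.inner_map_map (⟨J, h2⟩ : V →ₗᵢ[ℝ] V) v w
    have hJ : J * J = (-1 : ℝ) • (1 : V →ₗ[ℝ] V) := by
      ext v
      refine ext_inner_right ℝ fun w => ?_
      simp [hskew (J v) w, hiso]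
    have hd := congrArg LinearMap.det hJ
    rw [map_mul, LinearMap.det_smul, map_one, mul_one] at hd
    by_contra hne
    rw [Nat.not_even_iff_odd] at hne
    rw [hne.neg_one_pow] at hd
    nlinarith [mul_self_nonneg (LinearMap.det J)]
  · rintro ⟨k, hk⟩
    let b : OrthonormalBasis (Fin k ⊕ Fin k) ℝ V :=
      (stdOrthonormalBasis ℝ V).reindex ((finCongr hk).trans finSumFinEquiv.symm)
    let J0 : EuclideanSpace ℝ (Fin k ⊕ Fin k) →ₗ[ℝ] EuclideanSpace ℝ (Fin k ⊕ Fin k) :=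
      { toFun := fun x => WithLp.toLp 2
          (Sum.elim (fun i => - x (Sum.inr i)) (fun i => x (Sum.inl i)))
        map_add' := by
          intro x y
          ext i
          rcases i with i | i <;> simp <;> ring
        map_smul' := by
          intro c x
          ext i
          rcases i with i | i <;> simp }
    refine ⟨b.repr.symm.toLinearEquiv.toLinearMap ∘ₗ J0 ∘ₗ b.repr.toLinearEquiv.toLinearMap,
      fun v => ?_, fun v => ?_⟩
    · rw [← b.repr.inner_map_map]
      simp [J0, PiLp.inner_apply, Fintype.sum_sum_type, mul_comm]
    · rw [← b.repr.norm_map v, EuclideanSpace.norm_eq (b.repr v)]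
      simp [J0, EuclideanSpace.norm_eq, Fintype.sum_sum_type, add_comm]
end

section
/- Let V be a real inner product space of finite dimension m ≥ 2 and let χ be an (m−1)-fold vector cross product on V. Then for every orthonormal basis (e₁,…,e_m) of V one has φ_χ(e₁,…,e_m) = ⟪χ(e₁,…,e_{m-1}), e_m⟫ ∈ {1, −1}. Consequently there is an orientation of V such that φ_χ equals the volume form of V for that orientation. -/
open RealInnerProductSpace

/-- The VCP-form as an alternating map. -/
noncomputable def vcpForm {V : Type*} [NormedAddCommGroup V] [InnerProductSpace ℝ V] {n : ℕ}
    (χ : V [⋀^Fin (n + 1)]→ₗ[ℝ] V) (hχ : IsVCP χ) : V [⋀^Fin (n + 2)]→ₗ[ℝ] ℝ :=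
  { MultilinearMap.uncurryRight (M := fun _ : Fin (n + 2) => V)
      ((innerₗ V).compMultilinearMap χ.toMultilinearMap) with
    map_eq_zero_of_eq' := by
      intro v i j hv hij
      change ⟪χ (Fin.init v), v (Fin.last (n + 1))⟫ = 0
      induction i using Fin.lastCases with
      | last =>
        induction j using Fin.lastCases with
        | last => exact absurd rfl hij
        | cast j => rw [hv]; exact hχ.1 (Fin.init v) j
      | cast i =>
        induction j using Fin.lastCases with
        | last => rw [← hv]; exact hχ.1 (Fin.init v) i
        | cast j =>
          rw [χ.map_eq_zero_of_eq (Fin.init v) (i := i) (j := j) hv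
            (fun h => hij (by rw [h])), inner_zero_left] }

theorem vcpForm_apply {V : Type*} [NormedAddCommGroup V] [InnerProductSpace ℝ V] {n : ℕ}
    (χ : V [⋀^Fin (n + 1)]→ₗ[ℝ] V) (hχ : IsVCP χ) (v : Fin (n + 2) → V) :
    vcpForm χ hχ v = ⟪χ (Fin.init v), v (Fin.last (n + 1))⟫ := rfl

/-- Brown–Gray classification, case (2), uniqueness: for an `(m-1)`-fold vector cross
product `χ` on a real inner product space of dimension `m = n + 2 ≥ 2`, the value of the
VCP-form `φ_χ` on any orthonormal basis is `1` or `-1`, and there is an orientation of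
`V` for which `φ_χ` is the volume form. -/
theorem vcp_form_is_volume_form {V : Type*} [NormedAddCommGroup V]
    [InnerProductSpace ℝ V] {n : ℕ} [Fact (Module.finrank ℝ V = n + 2)]
    (χ : V [⋀^Fin (n + 1)]→ₗ[ℝ] V) (hχ : IsVCP χ) :
    (∀ b : OrthonormalBasis (Fin (n + 2)) ℝ V,
        ⟪χ (fun i : Fin (n + 1) => b i.castSucc), b (Fin.last (n + 1))⟫ = 1 ∨
        ⟪χ (fun i : Fin (n + 1) => b i.castSucc), b (Fin.last (n + 1))⟫ = -1) ∧
    (∃ o : Orientation ℝ V (Fin (n + 2)), ∀ v : Fin (n + 2) → V,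
        ⟪χ (Fin.init v), v (Fin.last (n + 1))⟫ = o.volumeForm v) := by
  have key : ∀ b : OrthonormalBasis (Fin (n + 2)) ℝ V,
        ⟪χ (fun i : Fin (n + 1) => b i.castSucc), b (Fin.last (n + 1))⟫ = 1 ∨
        ⟪χ (fun i : Fin (n + 1) => b i.castSucc), b (Fin.last (n + 1))⟫ = -1 := by
    intro b
    have h1 := hχ.2 (fun i : Fin (n + 1) => b i.castSucc)
    have h2 : (Matrix.of fun i j : Fin (n + 1) => ⟪b i.castSucc, b j.castSucc⟫) = 1 := by
      ext i j
      simp [b.inner_eq_ite, Matrix.one_apply]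
    rw [h2, Matrix.det_one, ← b.sum_sq_norm_inner_left, Fin.sum_univ_castSucc,
      Finset.sum_eq_zero, zero_add, Real.norm_eq_abs, sq_abs] at h1
    · simpa using h1
    · intro i _
      rw [hχ.1 (fun i : Fin (n + 1) => b i.castSucc) i]
      simp
  refine ⟨key, ?_⟩
  have hf : Module.finrank ℝ V = n + 2 := Fact.out
  have : FiniteDimensional ℝ V := Module.finite_of_finrank_pos (by omega)
  let b : OrthonormalBasis (Fin (n + 2)) ℝ V := (stdOrthonormalBasis ℝ V).reindex (finCongr hf)
  have hd := (vcpForm χ hχ).eq_smul_basis_det b.toBasis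
  have hb : vcpForm χ hχ b.toBasis =
      ⟪χ (fun i : Fin (n + 1) => b i.castSucc), b (Fin.last (n + 1))⟫ := by
    rw [vcpForm_apply, b.coe_toBasis]; rfl
  rcases key b with h | h
  · refine ⟨b.toBasis.orientation, fun v => ?_⟩
    rw [← vcpForm_apply χ hχ, hd, hb, h, Orientation.volumeForm_robust _ b rfl, one_smul]
  · refine ⟨-b.toBasis.orientation, fun v => ?_⟩
    rw [← vcpForm_apply χ hχ, hd, hb, h, Orientation.volumeForm_neg_orientation,
      Orientation.volumeForm_robust _ b rfl, AlternatingMap.smul_apply,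
      AlternatingMap.neg_apply, smul_eq_mul, neg_one_mul]
end
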